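/- arXiv:2208.01132 — 5 statements merged into one kernel-verified Lean document; each statement's English description precedes it below -/
import Mathlib

section
/- Let U ⊆ ℝ^n be open, X ⊆ U, and k ≥ 1. If f : U^{k+1} → ℝ is smooth and flat on the diagonal Δ_X^{k+1}, then the Hochschild boundary b f = Σ_{i=0}^{k} (−1)^i f ∘ D_i, which is a smooth function on U^k, is flat on the diagonal Δ_X^k. -/
open scoped BigOperators
open MeasureTheory

noncomputable section

abbrev Euc (n : ℕ) : Type := EuclideanSpace ℝ (Fin n)

/-- The `i`-th simplicial face map `D_i : E^k → E^{k+1}`. -/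
def face {n : ℕ} (k i : ℕ) (x : Fin k → Euc n) : Fin (k + 1) → Euc n :=
  fun l =>
    if _hle : (l : ℕ) ≤ i then
      if h : (l : ℕ) < k then x ⟨l, h⟩
      else if h0 : 0 < k then x ⟨0, h0⟩ else 0
    else x ⟨(l : ℕ) - 1, by have hl := l.isLt; omega⟩

/-- The Hochschild boundary `b f = ∑ (-1)^i f ∘ D_i`. -/
def hb {n k : ℕ} (f : (Fin (k + 1) → Euc n) → ℝ) : (Fin k → Euc n) → ℝ :=
  fun x => ∑ i ∈ Finset.range (k + 1), (-1 : ℝ) ^ i * f (face k i x)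

/-- Degeneracy `σ_i` omitting the `(i+1)`-st entry. -/
def degen {n : ℕ} (i : ℕ) {m : ℕ} (x : Fin (m + 1) → Euc n) : Fin m → Euc n :=
  fun l =>
    if (l : ℕ) ≤ i then x ⟨l, by have hl := l.isLt; omega⟩
    else x ⟨(l : ℕ) + 1, by have hl := l.isLt; omega⟩

/-- Squared distance of cyclically consecutive entries. -/
def dsq {n m : ℕ} (x : Fin m → Euc n) (j : ℕ) : ℝ :=
  if hm : 0 < m then
    ‖x ⟨j % m, Nat.mod_lt _ hm⟩ - x ⟨(j + 1) % m, Nat.mod_lt _ hm⟩‖ ^ 2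
  else 0

/-- Cutoff `Ψ` with `i` factors on `E^m`. -/
def Psi {n : ℕ} (ρ : ℝ → ℝ) (i : ℕ) (t : ℝ) {m : ℕ} (x : Fin m → Euc n) : ℝ :=
  ∏ j ∈ Finset.range i, ρ (dsq x j / t)

/-- `η_{m,i,t} g = Ψ_{m+1,i,t} · (g ∘ σ_{i-1})`. -/
def eta {n : ℕ} (ρ : ℝ → ℝ) (i : ℕ) (t : ℝ) {m : ℕ} (g : (Fin m → Euc n) → ℝ) :
    (Fin (m + 1) → Euc n) → ℝ :=
  fun x => Psi ρ i t x * g (degen (i - 1) x)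

/-- `H_{m,t} = ∑_{i=1}^{m+1} (-1)^{i+1} η_{m,i,t}`. -/
def Hmap {n : ℕ} (ρ : ℝ → ℝ) (t : ℝ) {m : ℕ} (g : (Fin m → Euc n) → ℝ) :
    (Fin (m + 1) → Euc n) → ℝ :=
  fun x => ∑ i ∈ Finset.Icc 1 m, (-1 : ℝ) ^ (i + 1) * eta ρ i t g x

/-- `K_{m,t} g = ∫_t^1 H_{m,s/2}(∂_s Ψ_{m,s} · g) ds`. -/
def Kmap {n : ℕ} (ρ : ℝ → ℝ) (t : ℝ) {m : ℕ} (g : (Fin m → Euc n) → ℝ) :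
    (Fin (m + 1) → Euc n) → ℝ :=
  fun x => ∫ s in t..(1 : ℝ), Hmap ρ (s / 2) (fun y => deriv (fun u => Psi ρ m u y) s * g y) x

/-- Standard basis vector in the `j`-th block, `l`-th coordinate. -/
def blockVec (n m j : ℕ) (l : Fin n) : Fin m → Euc n :=
  fun j' => if (j' : ℕ) = j then EuclideanSpace.single l 1 else 0

/-- Iterated partial derivative `∂^α_j`. -/
def mpderiv {n m : ℕ} (j : ℕ) (α : Fin n → ℕ) (g : (Fin m → Euc n) → ℝ) :
    (Fin m → Euc n) → ℝ :=
  (List.finRange n).foldr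
    (fun l gg => (fun h (x : Fin m → Euc n) => fderiv ℝ h x (blockVec n m j l))^[α l] gg) g


/-- The continuous linear map `x ↦ x ∘ φ` given by a reindexing of the entries. -/
def reindexCLM {n k m : ℕ} (φ : Fin m → Fin k) : (Fin k → Euc n) →L[ℝ] (Fin m → Euc n) :=
  ContinuousLinearMap.pi fun l => ContinuousLinearMap.proj (φ l)

theorem exists_face_eq_reindexCLM {n k : ℕ} (hk : 1 ≤ k) (i : ℕ) :
    ∃ φ : Fin (k + 1) → Fin k, (face k i : (Fin k → Euc n) → _) = reindexCLM φ := by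
  refine ⟨fun l => if (l : ℕ) ≤ i then if h : (l : ℕ) < k then ⟨l, h⟩ else ⟨0, hk⟩
    else ⟨(l : ℕ) - 1, by have := l.isLt; omega⟩, ?_⟩
  funext x l
  simp only [face, reindexCLM, ContinuousLinearMap.coe_pi', ContinuousLinearMap.proj_apply]
  split_ifs <;> first | rfl | omega

theorem isOpen_pow {n : ℕ} {U : Set (Euc n)} (hU : IsOpen U) (m : ℕ) :
    IsOpen {y : Fin m → Euc n | ∀ i, y i ∈ U} := by
  simpa [Set.pi] using isOpen_set_pi Set.finite_univ fun (_ : Fin m) _ => hU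

theorem contDiffOn_comp_face {n k : ℕ} (hk : 1 ≤ k) {U : Set (Euc n)}
    {f : (Fin (k + 1) → Euc n) → ℝ}
    (hf : ContDiffOn ℝ (⊤ : ℕ∞) f {y : Fin (k + 1) → Euc n | ∀ i, y i ∈ U}) (i : ℕ) :
    ContDiffOn ℝ (⊤ : ℕ∞) (fun x => f (face k i x)) {y : Fin k → Euc n | ∀ i, y i ∈ U} := by
  obtain ⟨φ, hφ⟩ := exists_face_eq_reindexCLM (n := n) hk i
  rw [hφ]
  exact hf.comp (reindexCLM φ).contDiff.contDiffOn fun x hx l => hx (φ l)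

theorem iteratedFDerivWithin_comp_face_eq_zero {n k : ℕ} (hk : 1 ≤ k) {U : Set (Euc n)}
    (hU : IsOpen U) {f : (Fin (k + 1) → Euc n) → ℝ}
    (hf : ContDiffOn ℝ (⊤ : ℕ∞) f {y : Fin (k + 1) → Euc n | ∀ i, y i ∈ U})
    {p : Euc n} (hp : p ∈ U) {r : ℕ}
    (h0 : iteratedFDerivWithin ℝ r f {y : Fin (k + 1) → Euc n | ∀ i, y i ∈ U} (fun _ => p) = 0)
    (i : ℕ) :
    iteratedFDerivWithin ℝ r (fun x => f (face k i x)) {y : Fin k → Euc n | ∀ i, y i ∈ U}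
      (fun _ => p) = 0 := by
  obtain ⟨φ, hφ⟩ := exists_face_eq_reindexCLM (n := n) hk i
  have hs := isOpen_pow hU (k + 1)
  have hs' := hs.preimage (reindexCLM (n := n) φ).continuous
  have hdiag : reindexCLM φ (fun _ => p) = fun _ => p := rfl
  have hmem : reindexCLM φ (fun _ => p) ∈ {y : Fin (k + 1) → Euc n | ∀ i, y i ∈ U} :=
    fun _ => hp
  have key := (reindexCLM φ).iteratedFDerivWithin_comp_right hf hs.uniqueDiffOn
    hs'.uniqueDiffOn hmem (i := r) (by exact_mod_cast le_top)
  rw [hdiag, h0, iteratedFDerivWithin_of_isOpen r hs' hmem] at key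
  rw [hφ, iteratedFDerivWithin_of_isOpen r (isOpen_pow hU k) fun _ => hp]
  refine key.trans ?_
  ext
  rfl

theorem stmt0 {n : ℕ} (hn : 1 ≤ n) {k : ℕ} (hk : 1 ≤ k)
    (U : Set (Euc n)) (hU : IsOpen U) (X : Set (Euc n)) (hXU : X ⊆ U)
    (f : (Fin (k + 1) → Euc n) → ℝ)
    (hf : ContDiffOn ℝ (⊤ : ℕ∞) f {y : Fin (k + 1) → Euc n | ∀ i, y i ∈ U})
    (hflat : ∀ (r : ℕ), ∀ p ∈ X,
      iteratedFDerivWithin ℝ r f {y : Fin (k + 1) → Euc n | ∀ i, y i ∈ U}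
        (fun _ => p) = 0) :
    ContDiffOn ℝ (⊤ : ℕ∞) (hb f) {y : Fin k → Euc n | ∀ i, y i ∈ U} ∧
      ∀ (r : ℕ), ∀ p ∈ X,
        iteratedFDerivWithin ℝ r (hb f) {y : Fin k → Euc n | ∀ i, y i ∈ U}
          (fun _ => p) = 0 := by
  have hterm (i : ℕ) : ContDiffOn ℝ (⊤ : ℕ∞) ((-1 : ℝ) ^ i • fun x => f (face k i x))
      {y : Fin k → Euc n | ∀ i, y i ∈ U} :=
    (contDiffOn_comp_face hk hf i).const_smul ((-1 : ℝ) ^ i)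
  have hu := (isOpen_pow hU k).uniqueDiffOn (𝕜 := ℝ)
  refine ⟨ContDiffOn.sum (f := fun i x => (-1 : ℝ) ^ i * f (face k i x)) fun i _ => hterm i,
    fun r p hp => ?_⟩
  have hpU : (fun _ => p) ∈ {y : Fin k → Euc n | ∀ i, y i ∈ U} := fun _ => hXU hp
  have hr : (r : WithTop ℕ∞) ≤ ((⊤ : ℕ∞) : WithTop ℕ∞) := by exact_mod_cast le_top
  refine (iteratedFDerivWithin_fun_sum_apply hu hpU
    fun i _ => ((hterm i).of_le hr) _ hpU).trans (Finset.sum_eq_zero fun i _ => ?_)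
  rw [iteratedFDerivWithin_const_smul_apply
      (((contDiffOn_comp_face hk hf i).of_le hr) _ hpU) hu hpU,
    iteratedFDerivWithin_comp_face_eq_zero hk hU hf (hXU hp) (hflat r p hp), smul_zero]
end
end

section
/- Let k ≥ 1, let f : (ℝ^n)^{k+1} → ℝ be smooth, let α : Fin n → ℕ be a multi-index, and let 0 ≤ i < k. Then the higher Leibniz rule holds for the duplicated block: ∂^α_i (f ∘ D_i) = Σ_{β+γ=α} binomial(α,β) · (∂^β_i ∂^γ_{i+1} f) ∘ D_i as functions on (ℝ^n)^k, where the sum runs over all pairs of multi-indices β, γ : Fin n → ℕ with β + γ = α. -/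
open scoped BigOperators
open MeasureTheory

noncomputable section

/-- The space of smooth real functions on `E^m`. -/
def smoothFun (n m : ℕ) : Submodule ℝ ((Fin m → Euc n) → ℝ) where
  carrier := {g | ContDiff ℝ (⊤ : ℕ∞) g}
  add_mem' ha hb := by
    rw [Set.mem_ofPred_eq] at *
    exact ha.add hb
  zero_mem' := by
    rw [Set.mem_ofPred_eq]
    exact contDiff_const
  smul_mem' c g hg := by
    rw [Set.mem_ofPred_eq] at *
    exact hg.const_smul c

theorem mem_smoothFun {n m : ℕ} {g : (Fin m → Euc n) → ℝ} :
    g ∈ smoothFun n m ↔ ContDiff ℝ (⊤ : ℕ∞) g := Iff.rfl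

theorem contDiff_smoothFun {n m : ℕ} (g : smoothFun n m) :
    ContDiff ℝ (⊤ : ℕ∞) (g : (Fin m → Euc n) → ℝ) := mem_smoothFun.1 g.2

theorem differentiableAt_smoothFun {n m : ℕ} (g : smoothFun n m) (x : Fin m → Euc n) :
    DifferentiableAt ℝ (g : (Fin m → Euc n) → ℝ) x :=
  ((contDiff_smoothFun g).differentiable (by simp)) x

/-- The directional derivative along `v`, as an endomorphism of the smooth functions. -/
def smoothDeriv {n m : ℕ} (v : Fin m → Euc n) : Module.End ℝ (smoothFun n m) where
  toFun g := ⟨fun x => fderiv ℝ (g : (Fin m → Euc n) → ℝ) x v,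
    ((contDiff_smoothFun g).fderiv_right (m := (⊤ : ℕ∞)) (by simp)).clm_apply contDiff_const⟩
  map_add' g h := by
    ext x
    simp [fderiv_add (differentiableAt_smoothFun g x) (differentiableAt_smoothFun h x)]
  map_smul' c g := by
    ext x
    simp [fderiv_const_smul (differentiableAt_smoothFun g x) c]

theorem coe_smoothDeriv {n m : ℕ} (v : Fin m → Euc n) (g : smoothFun n m) :
    (smoothDeriv v g : (Fin m → Euc n) → ℝ) =
      fun x => fderiv ℝ (g : (Fin m → Euc n) → ℝ) x v := rfl

theorem smoothDeriv_add {n m : ℕ} (v w : Fin m → Euc n) :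
    smoothDeriv (v + w) = smoothDeriv v + smoothDeriv w := by
  ext g x
  simp [coe_smoothDeriv]

theorem commute_smoothDeriv {n m : ℕ} (v w : Fin m → Euc n) :
    Commute (smoothDeriv v) (smoothDeriv w) := by
  have second (v w : Fin m → Euc n) (g : smoothFun n m) (x : Fin m → Euc n) :
      (smoothDeriv v (smoothDeriv w g) : (Fin m → Euc n) → ℝ) x =
        fderiv ℝ (fderiv ℝ (g : (Fin m → Euc n) → ℝ)) x v w := by
    have hd : DifferentiableAt ℝ (fderiv ℝ (g : (Fin m → Euc n) → ℝ)) x :=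
      (((contDiff_smoothFun g).fderiv_right (m := (⊤ : ℕ∞)) (by simp)).differentiable (by simp)) x
    simp [coe_smoothDeriv, fderiv_clm_apply hd (differentiableAt_const w)]
  ext g x
  have hsymm : IsSymmSndFDerivAt ℝ (g : (Fin m → Euc n) → ℝ) x :=
    ContDiffAt.isSymmSndFDerivAt (n := (⊤ : ℕ∞)) (contDiff_smoothFun g).contDiffAt (by simp; exact WithTop.coe_le_coe.mpr le_top)
  simpa only [Module.End.mul_apply, second] using hsymm v w

theorem coe_smoothDeriv_pow {n m : ℕ} (v : Fin m → Euc n) (a : ℕ) (g : smoothFun n m) :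
    ((smoothDeriv v ^ a) g : (Fin m → Euc n) → ℝ) =
      (fun h (x : Fin m → Euc n) => fderiv ℝ h x v)^[a] g := by
  induction a with
  | zero => rfl
  | succ a ih =>
    rw [pow_succ', Module.End.mul_apply, coe_smoothDeriv, ih, Function.iterate_succ_apply']

/-- The iterated partial derivative `∂^α_j` on smooth functions. -/
def smoothMpderiv {n m : ℕ} (j : ℕ) (α : Fin n → ℕ) : Module.End ℝ (smoothFun n m) :=
  ((List.finRange n).map fun l => smoothDeriv (blockVec n m j l) ^ α l).prod

theorem coe_smoothMpderiv {n m : ℕ} (j : ℕ) (α : Fin n → ℕ) (g : smoothFun n m) :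
    (smoothMpderiv j α g : (Fin m → Euc n) → ℝ) = mpderiv j α g := by
  unfold smoothMpderiv mpderiv
  induction List.finRange n with
  | nil => rfl
  | cons l L ih =>
    rw [List.map_cons, List.prod_cons, Module.End.mul_apply, coe_smoothDeriv_pow, ih,
      List.foldr_cons]

/-- Multi-index binomial theorem in a commutative semiring. -/
theorem prod_add_pow_multiindex {ι R : Type*} [Fintype ι] [DecidableEq ι] [CommSemiring R]
    (a b : ι → R) (α : ι → ℕ) :
    ∏ l, (a l + b l) ^ α l =
      ∑ β ∈ Finset.Iic α, (∏ l, (α l).choose (β l)) •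
        ((∏ l, a l ^ β l) * ∏ l, b l ^ (α - β) l) := by
  have hIic : Finset.Iic α = Fintype.piFinset fun l => Finset.range (α l + 1) := by
    ext β
    simp [Pi.le_def]
  simp_rw [add_pow, Finset.prod_univ_sum, hIic]
  refine Finset.sum_congr rfl fun β _ => ?_
  simp only [Finset.prod_mul_distrib, nsmul_eq_mul, Nat.cast_prod, Pi.sub_apply]
  ring

open scoped IsMulCommutative in
/-- Multi-index binomial theorem for commuting families in a ring. -/
theorem list_prod_add_pow_multiindex {n : ℕ} {R : Type*} [Ring R]
    (a b : Fin n → R) (haa : ∀ l l', Commute (a l) (a l')) (hab : ∀ l l', Commute (a l) (b l'))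
    (hbb : ∀ l l', Commute (b l) (b l')) (α : Fin n → ℕ) :
    ((List.finRange n).map fun l => (a l + b l) ^ α l).prod =
      ∑ β ∈ Finset.Iic α, (∏ l, (α l).choose (β l)) •
        (((List.finRange n).map fun l => a l ^ β l).prod *
          ((List.finRange n).map fun l => b l ^ (α - β) l).prod) := by
  let s : Set R := Set.range a ∪ Set.range b
  have hs : ∀ x ∈ s, ∀ y ∈ s, x * y = y * x := by
    rintro _ (⟨l, rfl⟩ | ⟨l, rfl⟩) _ (⟨l', rfl⟩ | ⟨l', rfl⟩)
    exacts [haa l l', hab l l', (hab l' l).symm, hbb l l']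
  have : IsMulCommutative (Subring.closure s) := Subring.isMulCommutative_closure hs
  let a' (l : Fin n) : Subring.closure s := ⟨a l, Subring.subset_closure (.inl ⟨l, rfl⟩)⟩
  let b' (l : Fin n) : Subring.closure s := ⟨b l, Subring.subset_closure (.inr ⟨l, rfl⟩)⟩
  have coe_prod (c : Fin n → Subring.closure s) :
      ((∏ l, c l : Subring.closure s) : R) = ((List.finRange n).map fun l => (c l : R)).prod := by
    rw [← List.prod_ofFn, List.ofFn_eq_map]
    exact (map_list_prod (Subring.closure s).subtype _).trans (by rw [List.map_map]; rfl)
  have h := congrArg (Subring.closure s).subtype (prod_add_pow_multiindex a' b' α)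
  rw [map_sum] at h
  simp only [map_nsmul, map_mul] at h
  simp only [Subring.subtype_apply, coe_prod] at h
  exact h

theorem face_apply {n k i : ℕ} (hik : i < k) (x : Fin k → Euc n) (l : Fin (k + 1)) :
    face k i x l = x ((⟨i, hik⟩ : Fin k).predAbove l) := by
  by_cases hl : (l : ℕ) ≤ i
  · rw [Fin.predAbove_of_le_castSucc _ _ (by simpa [Fin.le_def] using hl)]
    have : (l : ℕ) < k := by omega
    simp [face, hl, this, Fin.castPred, Fin.castLT]
  · rw [Fin.predAbove_of_castSucc_lt _ _ (by simpa [Fin.lt_def] using hl)]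
    simp only [face, hl, dite_false]
    rfl

/-- The face map as a continuous linear map. -/
def faceCLM (n : ℕ) {k i : ℕ} (hik : i < k) : (Fin k → Euc n) →L[ℝ] (Fin (k + 1) → Euc n) :=
  ContinuousLinearMap.pi fun l => ContinuousLinearMap.proj ((⟨i, hik⟩ : Fin k).predAbove l)

theorem coe_faceCLM {n k i : ℕ} (hik : i < k) : ⇑(faceCLM n hik) = face k i := by
  ext1 x
  ext1 l
  exact (face_apply hik x l).symm

theorem face_blockVec {n k i : ℕ} (hik : i < k) (l : Fin n) :
    face k i (blockVec n k i l) = blockVec n (k + 1) i l + blockVec n (k + 1) (i + 1) l := by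
  ext1 j
  rcases lt_trichotomy (j : ℕ) i with hj | hj | hj
  · have h1 : (j : ℕ) < k := by omega
    have h2 : (j : ℕ) ≠ i + 1 := by omega
    simp [face, blockVec, hj.le, h1, h2, hj.ne]
  · simp [face, blockVec, hj, hik]
  · have h1 : ¬ (j : ℕ) ≤ i := by omega
    have h2 : (j : ℕ) - 1 = i ↔ (j : ℕ) = i + 1 := by omega
    simp [face, blockVec, h1, h2, hj.ne']

/-- Pullback of smooth functions along the face map. -/
def facePullback {n k i : ℕ} (hik : i < k) (g : smoothFun n (k + 1)) : smoothFun n k :=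
  ⟨fun x => (g : (Fin (k + 1) → Euc n) → ℝ) (face k i x), by
    rw [mem_smoothFun, ← coe_faceCLM hik]
    exact (contDiff_smoothFun g).comp (faceCLM n hik).contDiff⟩

theorem smoothDeriv_facePullback {n k i : ℕ} (hik : i < k) (v : Fin k → Euc n)
    (g : smoothFun n (k + 1)) :
    smoothDeriv v (facePullback hik g) = facePullback hik (smoothDeriv (face k i v) g) := by
  ext x
  have h : HasFDerivAt (fun y => (g : (Fin (k + 1) → Euc n) → ℝ) (faceCLM n hik y)) _ x :=
    (differentiableAt_smoothFun g (faceCLM n hik x)).hasFDerivAt.comp x (faceCLM n hik).hasFDerivAt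
  rw [coe_faceCLM] at h
  simp [coe_smoothDeriv, facePullback, h.fderiv, coe_faceCLM]

theorem smoothDeriv_pow_facePullback {n k i : ℕ} (hik : i < k) (v : Fin k → Euc n) (a : ℕ)
    (g : smoothFun n (k + 1)) :
    (smoothDeriv v ^ a) (facePullback hik g) =
      facePullback hik ((smoothDeriv (face k i v) ^ a) g) := by
  induction a with
  | zero => rfl
  | succ a ih =>
    rw [pow_succ', Module.End.mul_apply, ih, smoothDeriv_facePullback, pow_succ',
      Module.End.mul_apply]

theorem smoothMpderiv_facePullback {n k i : ℕ} (hik : i < k) (α : Fin n → ℕ)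
    (g : smoothFun n (k + 1)) :
    smoothMpderiv i α (facePullback hik g) = facePullback hik
      (((List.finRange n).map fun l => (smoothDeriv (blockVec n (k + 1) i l) +
        smoothDeriv (blockVec n (k + 1) (i + 1) l)) ^ α l).prod g) := by
  unfold smoothMpderiv
  induction List.finRange n with
  | nil => rfl
  | cons l L ih =>
    simp only [List.map_cons, List.prod_cons, Module.End.mul_apply]
    rw [ih, smoothDeriv_pow_facePullback, face_blockVec hik, smoothDeriv_add]

/-- The higher Leibniz rule for the duplicated block, on smooth functions. -/
theorem smoothMpderiv_facePullback_eq_sum {n k i : ℕ} (hik : i < k) (α : Fin n → ℕ)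
    (g : smoothFun n (k + 1)) :
    smoothMpderiv i α (facePullback hik g) = facePullback hik
      (∑ β ∈ Finset.Iic α, (∏ l, (α l).choose (β l)) •
        smoothMpderiv i β (smoothMpderiv (i + 1) (α - β) g)) := by
  rw [smoothMpderiv_facePullback, list_prod_add_pow_multiindex
    (fun l => smoothDeriv (blockVec n (k + 1) i l))
    (fun l => smoothDeriv (blockVec n (k + 1) (i + 1) l))
    (fun _ _ => commute_smoothDeriv _ _) (fun _ _ => commute_smoothDeriv _ _)
    (fun _ _ => commute_smoothDeriv _ _), LinearMap.sum_apply]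
  rfl

theorem stmt5 {n : ℕ} (hn : 1 ≤ n) {k : ℕ} (hk : 1 ≤ k)
    (f : (Fin (k + 1) → Euc n) → ℝ) (hf : ContDiff ℝ (⊤ : ℕ∞) f)
    (α : Fin n → ℕ) (i : ℕ) (hik : i < k) :
    mpderiv i α (fun x : Fin k → Euc n => f (face k i x))
      = fun x : Fin k → Euc n =>
          ∑ β ∈ Finset.Iic α,
            (∏ l, ((α l).choose (β l) : ℝ)) *
              mpderiv i β (mpderiv (i + 1) (α - β) f) (face k i x) := by
  have h := congrArg Subtype.val
    (smoothMpderiv_facePullback_eq_sum hik α ⟨f, mem_smoothFun.2 hf⟩)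
  rw [coe_smoothMpderiv] at h
  refine h.trans ?_
  ext x
  simp [facePullback, coe_smoothMpderiv]
end
end

section
/- Let k ≥ 1, t > 0, 0 ≤ i ≤ k+1, and 0 ≤ j ≤ k−1 with i ≤ k whenever j ≥ i. Then for every x ∈ (ℝ^n)^k: Ψ_{k,i,t}(D_j x) = Ψ_{k−1,i−1,t}(x) if j < i, and Ψ_{k,i,t}(D_j x) = Ψ_{k−1,i,t}(x) if j ≥ i. Consequently, for every f : (ℝ^n)^{k+1} → ℝ, b_j(Ψ_{k,i,t}·f) = Ψ_{k−1,i−1,t}·(b_j f) if j < i and b_j(Ψ_{k,i,t}·f) = Ψ_{k−1,i,t}·(b_j f) if j ≥ i. -/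
open scoped BigOperators
open MeasureTheory

noncomputable section

/-- Below the duplicated entry, the distances are unchanged. -/
theorem dsq_face_of_lt {n k j l : ℕ} (hj : j < k) (hl : l < j) (x : Fin k → Euc n) :
    dsq (face k j x) l = dsq x l := by
  have hk : 0 < k := by omega
  have h1 : l % (k + 1) = l := Nat.mod_eq_of_lt (by omega)
  have h2 : (l + 1) % (k + 1) = l + 1 := Nat.mod_eq_of_lt (by omega)
  have h3 : l % k = l := Nat.mod_eq_of_lt (by omega)
  have h4 : (l + 1) % k = l + 1 := Nat.mod_eq_of_lt (by omega)
  have h5 : l ≤ j := by omega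
  have h6 : l + 1 ≤ j := by omega
  have h7 : l < k := by omega
  have h8 : l + 1 < k := by omega
  simp only [dsq, face, h1, h2, h3, h4, h5, h6, h7, h8, hk, Nat.succ_pos, dite_true]

/-- The duplicated entries have distance zero. -/
theorem dsq_face_self {n k j : ℕ} (hj : j < k) (x : Fin k → Euc n) :
    dsq (face k j x) j = 0 := by
  have h1 : j % (k + 1) = j := Nat.mod_eq_of_lt (by omega)
  have h2 : (j + 1) % (k + 1) = j + 1 := Nat.mod_eq_of_lt (by omega)
  simp [dsq, face, h1, h2, hj]

/-- Above the duplicated entry, the distances are shifted by one. -/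
theorem dsq_face_succ {n k j l : ℕ} (hl : j ≤ l) (hlk : l < k) (x : Fin k → Euc n) :
    dsq (face k j x) (l + 1) = dsq x l := by
  have hk : 0 < k := by omega
  have h1 : (l + 1) % (k + 1) = l + 1 := Nat.mod_eq_of_lt (by omega)
  have h3 : l % k = l := Nat.mod_eq_of_lt hlk
  have h5 : ¬ l + 1 ≤ j := by omega
  rcases Nat.lt_or_ge (l + 1) k with h | h
  · have h2 : (l + 1 + 1) % (k + 1) = l + 1 + 1 := Nat.mod_eq_of_lt (by omega)
    have h4 : (l + 1) % k = l + 1 := Nat.mod_eq_of_lt h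
    have h6 : ¬ l + 1 + 1 ≤ j := by omega
    simp [dsq, face, h1, h2, h3, h4, h5, h6, hk]
  · obtain rfl : k = l + 1 := by omega
    simp [dsq, face, h1, h3, h5]

theorem Psi_face_of_le {n k i j : ℕ} (ρ : ℝ → ℝ) (t : ℝ) (hj : j < k) (hij : i ≤ j)
    (x : Fin k → Euc n) : Psi ρ i t (face k j x) = Psi ρ i t x :=
  Finset.prod_congr rfl fun l hl => by
    rw [dsq_face_of_lt hj ((Finset.mem_range.mp hl).trans_le hij)]

theorem Psi_succ_face {n k i j : ℕ} (ρ : ℝ → ℝ) (hρ : ρ 0 = 1) (t : ℝ) (hj : j < k)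
    (hji : j ≤ i) (hik : i ≤ k) (x : Fin k → Euc n) :
    Psi ρ (i + 1) t (face k j x) = Psi ρ i t x := by
  induction i, hji using Nat.le_induction with
  | base =>
    have h := Psi_face_of_le ρ t hj le_rfl x
    unfold Psi at h ⊢
    rw [Finset.prod_range_succ, h, dsq_face_self hj, zero_div, hρ, mul_one]
  | succ m hm ih =>
    have h := ih (by omega)
    unfold Psi at h ⊢
    rw [Finset.prod_range_succ, h, dsq_face_succ hm (by omega), ← Finset.prod_range_succ]

theorem stmt7 {n : ℕ} (hn : 1 ≤ n)
    (ρ : ℝ → ℝ) (hρsmooth : ContDiff ℝ (⊤ : ℕ∞) ρ)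
    (hρ0 : ∀ r : ℝ, 0 ≤ ρ r) (hρ1 : ∀ r : ℝ, ρ r ≤ 1)
    (hρone : ∀ r : ℝ, r ≤ 1 / 3 → ρ r = 1) (hρzero : ∀ r : ℝ, 1 / 2 < r → ρ r = 0)
    {k : ℕ} (hk : 1 ≤ k) (t : ℝ) (ht : 0 < t)
    (i j : ℕ) (hi : i ≤ k + 1) (hj : j ≤ k - 1) (hij : i ≤ j → i ≤ k) :
    (∀ x : Fin k → Euc n,
        (j < i → Psi ρ i t (face k j x) = Psi ρ (i - 1) t x) ∧
        (i ≤ j → Psi ρ i t (face k j x) = Psi ρ i t x)) ∧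
      ∀ (f : (Fin (k + 1) → Euc n) → ℝ) (x : Fin k → Euc n),
        (j < i →
          Psi ρ i t (face k j x) * f (face k j x) = Psi ρ (i - 1) t x * f (face k j x)) ∧
        (i ≤ j →
          Psi ρ i t (face k j x) * f (face k j x) = Psi ρ i t x * f (face k j x)) := by
  have hjk : j < k := by omega
  have below (x : Fin k → Euc n) (h : j < i) :
      Psi ρ i t (face k j x) = Psi ρ (i - 1) t x := by
    obtain ⟨m, rfl⟩ : ∃ m, i = m + 1 := ⟨i - 1, by omega⟩
    exact Psi_succ_face ρ (hρone 0 (by norm_num)) t hjk (by omega) (by omega) x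
  have above (x : Fin k → Euc n) (h : i ≤ j) :
      Psi ρ i t (face k j x) = Psi ρ i t x := Psi_face_of_le ρ t hjk h x
  exact ⟨fun x => ⟨below x, above x⟩,
    fun f x => ⟨fun h => by rw [below x h], fun h => by rw [above x h]⟩⟩
end
end

section
/- Let k ≥ 1 and t > 0. Then for every function f : (ℝ^n)^{k+1} → ℝ one has, pointwise on (ℝ^n)^{k+1}: b(η_{k,1,t} f) + η_{k−1,1,t}(b f) = f − Ψ_{k,1,t}·f + Ψ_{k,1,t}·s_{k−1,0}(b_0 f). -/
open scoped BigOperators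
open MeasureTheory

noncomputable section

theorem degen_zero_face_of_le_one {n m i : ℕ} (hi : i ≤ 1) (x : Fin m → Euc n) :
    degen 0 (face m i x) = x := by
  funext l
  rcases l with ⟨_ | l, hl⟩
  · simp [degen, face, hl]
  · have h : ¬ l + 1 + 1 ≤ i := by omega
    simp [degen, face, h]

theorem degen_zero_face_succ {n k : ℕ} (hk : 1 ≤ k) (i : ℕ) (hi : 1 ≤ i)
    (x : Fin (k + 1) → Euc n) :
    degen 0 (face (k + 1) (i + 1) x) = face k i (degen 0 x) := by
  funext l
  have hl := l.isLt
  simp only [degen, face]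
  grind

theorem Psi_one {n m : ℕ} (ρ : ℝ → ℝ) (t : ℝ) (x : Fin (m + 2) → Euc n) :
    Psi ρ 1 t x = ρ (‖x 0 - x 1‖ ^ 2 / t) := by
  simp [Psi, dsq]

theorem Psi_one_face_zero {n m : ℕ} (ρ : ℝ → ℝ) (t : ℝ) (x : Fin (m + 1) → Euc n) :
    Psi ρ 1 t (face (m + 1) 0 x) = ρ 0 := by
  rw [Psi_one]
  simp [face]

theorem Psi_one_face_of_pos {n m i : ℕ} (hi : 1 ≤ i) (ρ : ℝ → ℝ) (t : ℝ)
    (x : Fin (m + 2) → Euc n) :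
    Psi ρ 1 t (face (m + 2) i x) = Psi ρ 1 t x := by
  rw [Psi_one, Psi_one]
  simp [face, hi]

theorem stmt11 {n : ℕ} (hn : 1 ≤ n)
    (ρ : ℝ → ℝ) (hρsmooth : ContDiff ℝ (⊤ : ℕ∞) ρ)
    (hρ0 : ∀ r : ℝ, 0 ≤ ρ r) (hρ1 : ∀ r : ℝ, ρ r ≤ 1)
    (hρone : ∀ r : ℝ, r ≤ 1 / 3 → ρ r = 1) (hρzero : ∀ r : ℝ, 1 / 2 < r → ρ r = 0)
    {k : ℕ} (hk : 1 ≤ k) (t : ℝ) (ht : 0 < t)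
    (f : (Fin (k + 1) → Euc n) → ℝ) (x : Fin (k + 1) → Euc n) :
    hb (eta ρ 1 t f) x + eta ρ 1 t (hb f) x
      = f x - Psi ρ 1 t x * f x + Psi ρ 1 t x * f (face k 0 (degen 0 x)) := by
  obtain ⟨m, rfl⟩ := Nat.exists_eq_add_of_le' hk
  have hρ : ρ 0 = 1 := hρone 0 (by norm_num)
  have hshift : ∀ i ∈ Finset.range (m + 1),
      (-1 : ℝ) ^ (i + 1 + 1) * eta ρ 1 t f (face (m + 1 + 1) (i + 1 + 1) x)
        = -(Psi ρ 1 t x * ((-1 : ℝ) ^ (i + 1) * f (face (m + 1) (i + 1) (degen 0 x)))) := by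
    intro i _
    rw [eta, Psi_one_face_of_pos (by omega), Nat.sub_self,
      degen_zero_face_succ hk (i + 1) (by omega)]
    ring
  have hleft : hb (eta ρ 1 t f) x = f x - Psi ρ 1 t x * f x
      - Psi ρ 1 t x * ∑ i ∈ Finset.range (m + 1),
          (-1 : ℝ) ^ (i + 1) * f (face (m + 1) (i + 1) (degen 0 x)) := by
    rw [hb, Finset.sum_range_succ', Finset.sum_range_succ', Finset.sum_congr rfl hshift,
      Finset.sum_neg_distrib, ← Finset.mul_sum, eta, eta, Psi_one_face_zero, hρ,
      Psi_one_face_of_pos (by omega), Nat.sub_self,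
      degen_zero_face_of_le_one (by omega), degen_zero_face_of_le_one (by omega)]
    ring
  have hright : eta ρ 1 t (hb f) x = Psi ρ 1 t x * (∑ i ∈ Finset.range (m + 1),
      (-1 : ℝ) ^ (i + 1) * f (face (m + 1) (i + 1) (degen 0 x))
        + f (face (m + 1) 0 (degen 0 x))) := by
    rw [eta, hb, Finset.sum_range_succ', Nat.sub_self, pow_zero, one_mul]
  rw [hleft, hright]
  ring
end
end

section
/- Let k ≥ 0, s > 0, and x ∈ (ℝ^n)^{k+1}. If Ψ_{k,s/2}(x) ≠ 0, then Ψ_{k,u}(x) = 1 for every u ≥ 3s/4; in particular the function u ↦ Ψ_{k,u}(x) is constant in a neighborhood of s and its derivative at s vanishes: deriv (u ↦ Ψ_{k,u}(x)) s = 0. -/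
open scoped BigOperators
open MeasureTheory

noncomputable section

theorem stmt15 {n : ℕ} (hn : 1 ≤ n)
    (ρ : ℝ → ℝ) (hρsmooth : ContDiff ℝ (⊤ : ℕ∞) ρ)
    (hρ0 : ∀ r : ℝ, 0 ≤ ρ r) (hρ1 : ∀ r : ℝ, ρ r ≤ 1)
    (hρone : ∀ r : ℝ, r ≤ 1 / 3 → ρ r = 1) (hρzero : ∀ r : ℝ, 1 / 2 < r → ρ r = 0)
    (k : ℕ) (s : ℝ) (hs : 0 < s)
    (x : Fin (k + 1) → Euc n) (hx : Psi ρ (k + 1) (s / 2) x ≠ 0) :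
    (∀ u : ℝ, 3 * s / 4 ≤ u → Psi ρ (k + 1) u x = 1) ∧
      deriv (fun u => Psi ρ (k + 1) u x) s = 0 := by
  have hd : ∀ j ∈ Finset.range (k + 1), dsq x j ≤ s / 4 := by
    intro j hj
    by_contra! h
    refine Finset.prod_ne_zero_iff.mp hx j hj (hρzero _ ?_)
    rw [lt_div_iff₀ (by positivity)]
    linarith
  have hone : ∀ u : ℝ, 3 * s / 4 ≤ u → Psi ρ (k + 1) u x = 1 := by
    intro u hu
    refine Finset.prod_eq_one fun j hj => hρone _ ?_
    rw [div_le_iff₀ (by linarith)]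
    linarith [hd j hj]
  refine ⟨hone, ?_⟩
  have hev : (fun u => Psi ρ (k + 1) u x) =ᶠ[nhds s] fun _ => (1 : ℝ) := by
    filter_upwards [Ici_mem_nhds (show 3 * s / 4 < s by linarith)] with u hu
    exact hone u hu
  rw [hev.deriv_eq, deriv_const]
end
end
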